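/- arXiv:2411.03821 — 5 statements merged into one kernel-verified Lean document; each statement's English description precedes it below -/
import Mathlib

section
/- For any type A and any lists x, y, z over A, the shuffle operation is associative in the sense of multioperations: ⋃_{v ∈ y ⧢ z} (x ⧢ v) = ⋃_{u ∈ x ⧢ y} (u ⧢ z). -/
/-- The shuffle of two lists: the set of all interleavings. -/
def shuffle {A : Type*} : List A → List A → Set (List A)
  | u, [] => {u}
  | [], u => {u}
  | x :: u, y :: v =>
      (fun w => x :: w) '' shuffle u (y :: v) ∪ (fun w => y :: w) '' shuffle (x :: u) v
  termination_by u v => u.length + v.length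

theorem nil_mem_shuffle {A : Type*} {u v : List A} : [] ∈ shuffle u v ↔ u = [] ∧ v = [] := by
  cases u <;> cases v <;> simp [shuffle]

theorem cons_mem_shuffle {A : Type*} {a : A} {w u v : List A} :
    a :: w ∈ shuffle u v ↔
      (∃ u', u = a :: u' ∧ w ∈ shuffle u' v) ∨ ∃ v', v = a :: v' ∧ w ∈ shuffle u v' := by
  have nil_shuffle (t : List A) : shuffle [] t = {t} := by cases t <;> simp [shuffle]
  cases u <;> cases v <;> simp [shuffle, nil_shuffle] <;> grind

theorem exists_mem_shuffle_assoc {A : Type*} (w x y z : List A) :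
    (∃ v ∈ shuffle y z, w ∈ shuffle x v) ↔ ∃ u ∈ shuffle x y, w ∈ shuffle u z := by
  induction w generalizing x y z with
  | nil => simp [nil_mem_shuffle, and_assoc, and_comm]
  | cons a w ih =>
    simp only [cons_mem_shuffle]
    constructor
    · rintro ⟨v, hv, ⟨x', rfl, hw⟩ | ⟨v', rfl, hw⟩⟩
      · obtain ⟨u, hu, hw⟩ := (ih x' y z).1 ⟨v, hv, hw⟩
        exact ⟨a :: u, cons_mem_shuffle.2 (.inl ⟨x', rfl, hu⟩), .inl ⟨u, rfl, hw⟩⟩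
      · rcases cons_mem_shuffle.1 hv with ⟨y', rfl, hv'⟩ | ⟨z', rfl, hv'⟩
        · obtain ⟨u, hu, hw⟩ := (ih x y' z).1 ⟨v', hv', hw⟩
          exact ⟨a :: u, cons_mem_shuffle.2 (.inr ⟨y', rfl, hu⟩), .inl ⟨u, rfl, hw⟩⟩
        · obtain ⟨u, hu, hw⟩ := (ih x y z').1 ⟨v', hv', hw⟩
          exact ⟨u, hu, .inr ⟨z', rfl, hw⟩⟩
    · rintro ⟨u, hu, ⟨u', rfl, hw⟩ | ⟨z', rfl, hw⟩⟩
      · rcases cons_mem_shuffle.1 hu with ⟨x', rfl, hu'⟩ | ⟨y', rfl, hu'⟩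
        · obtain ⟨v, hv, hw⟩ := (ih x' y z).2 ⟨u', hu', hw⟩
          exact ⟨v, hv, .inl ⟨x', rfl, hw⟩⟩
        · obtain ⟨v, hv, hw⟩ := (ih x y' z).2 ⟨u', hu', hw⟩
          exact ⟨a :: v, cons_mem_shuffle.2 (.inl ⟨y', rfl, hv⟩), .inr ⟨v, rfl, hw⟩⟩
      · obtain ⟨v, hv, hw⟩ := (ih x y z').2 ⟨u, hu, hw⟩
        exact ⟨a :: v, cons_mem_shuffle.2 (.inr ⟨z', rfl, hv⟩), .inr ⟨v, rfl, hw⟩⟩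

/-- The shuffle operation is associative in the sense of multioperations. -/
theorem shuffle_assoc {A : Type*} (x y z : List A) :
    (⋃ v ∈ shuffle y z, shuffle x v) = ⋃ u ∈ shuffle x y, shuffle u z := by
  ext w
  simpa using exists_mem_shuffle_assoc w x y z
end

section
/- Concatenation and shuffle of words satisfy the interchange law: for any lists u, v, u', v', w, w' over A, if w ∈ u ⧢ v and w' ∈ u' ⧢ v', then w ++ w' ∈ (u ++ u') ⧢ (v ++ v'). Hence the set of words over A, with concatenation and shuffle, forms a lax double monoid in the monoidal category of sets and relations. -/
theorem shuffle_nil_right {A : Type*} (u : List A) : shuffle u [] = {u} := by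
  simp [shuffle]

theorem shuffle_nil_left {A : Type*} (v : List A) : shuffle [] v = {v} := by
  cases v <;> simp [shuffle]

theorem cons_mem_shuffle_cons_left {A : Type*} (x : A) {u v w : List A}
    (h : w ∈ shuffle u v) : x :: w ∈ shuffle (x :: u) v := by
  cases v with
  | nil => simpa [shuffle_nil_right] using h
  | cons y v =>
    rw [shuffle]
    exact Or.inl ⟨w, h, rfl⟩

theorem cons_mem_shuffle_cons_right {A : Type*} (y : A) {u v w : List A}
    (h : w ∈ shuffle u v) : y :: w ∈ shuffle u (y :: v) := by
  cases u with
  | nil => simpa [shuffle_nil_left] using h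
  | cons x u =>
    rw [shuffle]
    exact Or.inr ⟨w, h, rfl⟩

theorem append_mem_shuffle_append_left {A : Type*} (u : List A) {u' v' w' : List A}
    (h : w' ∈ shuffle u' v') : u ++ w' ∈ shuffle (u ++ u') v' := by
  induction u with
  | nil => exact h
  | cons x u ih => exact cons_mem_shuffle_cons_left x ih

theorem append_mem_shuffle_append_right {A : Type*} (v : List A) {u' v' w' : List A}
    (h : w' ∈ shuffle u' v') : v ++ w' ∈ shuffle u' (v ++ v') := by
  induction v with
  | nil => exact h
  | cons y v ih => exact cons_mem_shuffle_cons_right y ih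

/-- Concatenation and shuffle of words satisfy the interchange law, making the set of
words over `A` a lax double monoid in the monoidal category of sets and relations. -/
theorem shuffle_concat_interchange {A : Type*} {u v u' v' w w' : List A}
    (h : w ∈ shuffle u v) (h' : w' ∈ shuffle u' v') :
    w ++ w' ∈ shuffle (u ++ u') (v ++ v') := by
  induction u, v using shuffle.induct generalizing w with
  | case1 u =>
    rw [shuffle_nil_right, Set.mem_singleton_iff] at h
    subst h
    exact append_mem_shuffle_append_left w h'
  | case2 v =>
    rw [shuffle_nil_left, Set.mem_singleton_iff] at h
    subst h
    exact append_mem_shuffle_append_right w h'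
  | case3 x u y v ihu ihv =>
    rw [shuffle] at h
    rcases h with ⟨t, ht, rfl⟩ | ⟨t, ht, rfl⟩
    · exact cons_mem_shuffle_cons_left x (ihu ht)
    · exact cons_mem_shuffle_cons_right y (ihv ht)
end

section
/- Let M and N be modules over the Boolean semiring, each equipped with the canonical order x ≤ y iff x + y = y, and let M ⊗ N be their tensor product over the Boolean semiring with its canonical order. If m is the greatest lower bound of m₁ and m₂ in M and n is the greatest lower bound of n₁ and n₂ in N, then the elementary tensor m ⊗ n is the greatest lower bound of m₁ ⊗ n₁ and m₂ ⊗ n₂ in M ⊗ N. -/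
/-- The Boolean semiring `𝔹`: the two-element semiring with `1 + 1 = 1`
(addition is `or`, multiplication is `and`). -/
def BoolSR : Type := Bool

instance : Zero BoolSR := ⟨(false : Bool)⟩
instance : One BoolSR := ⟨(true : Bool)⟩
instance : Add BoolSR := ⟨fun x y => (Bool.or x y : Bool)⟩
instance : Mul BoolSR := ⟨fun x y => (Bool.and x y : Bool)⟩

instance : CommSemiring BoolSR where
  add_assoc := Bool.or_assoc
  zero_add := Bool.false_or
  add_zero := Bool.or_false
  add_comm := Bool.or_comm
  nsmul := nsmulRec
  mul_assoc := Bool.and_assoc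
  one_mul := Bool.true_and
  mul_one := Bool.and_true
  mul_comm := Bool.and_comm
  left_distrib := Bool.and_or_distrib_left
  right_distrib := Bool.and_or_distrib_right
  zero_mul := Bool.false_and
  mul_zero := Bool.and_false

namespace BoolSR

variable {M N : Type*} [AddCommMonoid M] [Module BoolSR M] [AddCommMonoid N] [Module BoolSR N]

theorem eq_zero_or_eq_one (c : BoolSR) : c = 0 ∨ c = 1 :=
  (Bool.eq_false_or_eq_true c).symm

theorem one_ne_zero : (1 : BoolSR) ≠ 0 := Bool.noConfusion

theorem one_add (c : BoolSR) : 1 + c = 1 := Bool.true_or c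

theorem add_self (x : M) : x + x = x := by
  rw [← one_smul BoolSR x, ← add_smul, one_add]

theorem add_eq_of_add_add_eq {x y a : M} (h : x + y + a = a) : x + a = a := by
  rw [← h, ← add_assoc, ← add_assoc, add_self]

theorem add_add_eq_iff {x y a : M} : x + y + a = a ↔ x + a = a ∧ y + a = a := by
  refine ⟨fun h => ⟨add_eq_of_add_add_eq h, add_eq_of_add_add_eq (add_comm x y ▸ h)⟩, ?_⟩
  rintro ⟨hx, hy⟩
  rw [add_assoc, hy, hx]

open Classical in
/-- The functional vanishing exactly on the elements below `a`. -/
noncomputable def notLe (a : M) : M →ₗ[BoolSR] BoolSR where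
  toFun x := if x + a = a then 0 else 1
  map_add' x y := by
    simp only [add_add_eq_iff]
    by_cases hx : x + a = a <;> by_cases hy : y + a = a <;> simp [hx, hy, one_add]
  map_smul' c x := by
    rcases eq_zero_or_eq_one c with rfl | rfl <;> simp

theorem notLe_eq_zero_iff {a x : M} : notLe a x = 0 ↔ x + a = a := by
  simp [notLe, one_ne_zero]

theorem mul_eq_zero {c d : BoolSR} (h : c * d = 0) : c = 0 ∨ d = 0 := by
  rcases eq_zero_or_eq_one c with rfl | rfl
  · exact Or.inl rfl
  · exact Or.inr (by rwa [one_mul] at h)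

open TensorProduct

theorem mul_eq_zero_of_tmul_add_tmul_eq {x a : M} {y b : N}
    (h : x ⊗ₜ[BoolSR] y + a ⊗ₜ[BoolSR] b = a ⊗ₜ[BoolSR] b)
    (φ : M →ₗ[BoolSR] BoolSR) (ψ : N →ₗ[BoolSR] BoolSR) (hab : φ a * ψ b = 0) :
    φ x * ψ y = 0 := by
  have := congrArg (LinearMap.mul' BoolSR BoolSR ∘ₗ TensorProduct.map φ ψ) h
  simpa [hab] using this

/-- Elementary tensors are compared componentwise, unless the smaller one is trivially zero. -/
theorem le_and_le_of_tmul_le_tmul {x a : M} {y b : N} (hx : x ≠ 0) (hy : y ≠ 0)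
    (h : x ⊗ₜ[BoolSR] y + a ⊗ₜ[BoolSR] b = a ⊗ₜ[BoolSR] b) :
    x + a = a ∧ y + b = b := by
  have ha : notLe a a = 0 := notLe_eq_zero_iff.2 (add_self a)
  have hb : notLe b b = 0 := notLe_eq_zero_iff.2 (add_self b)
  have h₁ := mul_eq_zero (mul_eq_zero_of_tmul_add_tmul_eq h (notLe a) (notLe 0)
    (by rw [ha, zero_mul]))
  have h₂ := mul_eq_zero (mul_eq_zero_of_tmul_add_tmul_eq h (notLe 0) (notLe b)
    (by rw [hb, mul_zero]))
  simp only [notLe_eq_zero_iff, add_zero, hx, hy, or_false, false_or] at h₁ h₂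
  exact ⟨h₁, h₂⟩

theorem tmul_le_tmul {x a : M} {y b : N} (hx : x + a = a) (hy : y + b = b) :
    x ⊗ₜ[BoolSR] y + a ⊗ₜ[BoolSR] b = a ⊗ₜ[BoolSR] b := by
  rw [← hx, ← hy, tmul_add, add_tmul, add_tmul, add_assoc (x ⊗ₜ[BoolSR] y), ← add_assoc,
    add_self]

end BoolSR

open BoolSR in
open TensorProduct in
/-- For modules `M`, `N` over the Boolean semiring with their canonical orders
(`x ≤ y ↔ x + y = y`), if `m = m₁ ⊓ m₂` in `M` and `n = n₁ ⊓ n₂` in `N`, then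
`m ⊗ n = (m₁ ⊗ n₁) ⊓ (m₂ ⊗ n₂)` in `M ⊗ N` with its canonical order. -/
theorem tensor_meet {M N : Type*} [AddCommMonoid M] [Module BoolSR M]
    [AddCommMonoid N] [Module BoolSR N]
    (m m₁ m₂ : M) (n n₁ n₂ : N)
    (hm₁ : m + m₁ = m₁) (hm₂ : m + m₂ = m₂)
    (hmglb : ∀ w : M, w + m₁ = m₁ → w + m₂ = m₂ → w + m = m)
    (hn₁ : n + n₁ = n₁) (hn₂ : n + n₂ = n₂)
    (hnglb : ∀ w : N, w + n₁ = n₁ → w + n₂ = n₂ → w + n = n) :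
    (m ⊗ₜ[BoolSR] n + m₁ ⊗ₜ[BoolSR] n₁ = m₁ ⊗ₜ[BoolSR] n₁) ∧
    (m ⊗ₜ[BoolSR] n + m₂ ⊗ₜ[BoolSR] n₂ = m₂ ⊗ₜ[BoolSR] n₂) ∧
    (∀ t : M ⊗[BoolSR] N, t + m₁ ⊗ₜ[BoolSR] n₁ = m₁ ⊗ₜ[BoolSR] n₁ →
      t + m₂ ⊗ₜ[BoolSR] n₂ = m₂ ⊗ₜ[BoolSR] n₂ → t + m ⊗ₜ[BoolSR] n = m ⊗ₜ[BoolSR] n) := by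
  refine ⟨tmul_le_tmul hm₁ hn₁, tmul_le_tmul hm₂ hn₂, fun t h₁ h₂ => ?_⟩
  induction t using TensorProduct.induction_on with
  | zero => exact zero_add _
  | tmul x y =>
    by_cases hx : x = 0
    · rw [hx, zero_tmul, zero_add]
    by_cases hy : y = 0
    · rw [hy, tmul_zero, zero_add]
    obtain ⟨hx₁, hy₁⟩ := le_and_le_of_tmul_le_tmul hx hy h₁
    obtain ⟨hx₂, hy₂⟩ := le_and_le_of_tmul_le_tmul hx hy h₂
    exact tmul_le_tmul (hmglb x hx₁ hx₂) (hnglb y hy₁ hy₂)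
  | add s t hs ht =>
    rw [add_add_eq_iff] at h₁ h₂ ⊢
    exact ⟨hs h₁.1 h₂.1, ht h₁.2 h₂.2⟩
end

section
/- Let α, β, γ, δ be preorders. Equip α ⊕ₗ β and γ ⊕ₗ δ with the ordinal (lexicographic) sum order, form their disjoint union (α ⊕ₗ β) ⊔ (γ ⊕ₗ δ) with the disjoint-union order, and equip (α ⊔ γ) ⊕ₗ (β ⊔ δ) with the ordinal sum of the two disjoint-union orders. Then the canonical bijection (α ⊕ₗ β) ⊔ (γ ⊕ₗ δ) → (α ⊔ γ) ⊕ₗ (β ⊔ δ) (rearranging the four summands) is monotone. This is the interchange morphism χ : (A ⊙ B) ⊔ (C ⊙ D) → (A ⊔ C) ⊙ (B ⊔ D) relating the join and disjoint-union monoidal structures on posets, and it is in general not an order isomorphism. -/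
/-- The canonical rearrangement bijection
`(α ⊕ₗ β) ⊔ (γ ⊕ₗ δ) → (α ⊔ γ) ⊕ₗ (β ⊔ δ)`, i.e. the interchange morphism `χ`
relating the join (ordinal sum) and disjoint-union monoidal structures on posets. -/
def chiMap {α β γ δ : Type*} : (α ⊕ₗ β) ⊕ (γ ⊕ₗ δ) → (α ⊕ γ) ⊕ₗ (β ⊕ δ)
  | Sum.inl x =>
      match ofLex x with
      | Sum.inl a => toLex (Sum.inl (Sum.inl a))
      | Sum.inr b => toLex (Sum.inr (Sum.inl b))
  | Sum.inr y =>
      match ofLex y with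
      | Sum.inl c => toLex (Sum.inl (Sum.inr c))
      | Sum.inr d => toLex (Sum.inr (Sum.inr d))

/-- The interchange morphism `χ : (A ⊙ B) ⊔ (C ⊙ D) → (A ⊔ C) ⊙ (B ⊔ D)` is a monotone
bijection (but in general not an order isomorphism). -/
theorem chiMap_bijective_monotone {α β γ δ : Type*}
    [Preorder α] [Preorder β] [Preorder γ] [Preorder δ] :
    Function.Bijective (chiMap (α := α) (β := β) (γ := γ) (δ := δ)) ∧
    Monotone (chiMap (α := α) (β := β) (γ := γ) (δ := δ)) := by
  refine ⟨⟨?_, ?_⟩, ?_⟩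
  · rintro (x | x) (y | y) h <;> induction x using Lex.rec with | _ x <;>
      induction y using Lex.rec with | _ y <;> rcases x with x | x <;> rcases y with y | y <;>
      simp_all [chiMap]
  · intro z
    induction z using Lex.rec with | _ z
    rcases z with (a | c) | (b | d)
    · exact ⟨Sum.inl (toLex (Sum.inl a)), rfl⟩
    · exact ⟨Sum.inr (toLex (Sum.inl c)), rfl⟩
    · exact ⟨Sum.inl (toLex (Sum.inr b)), rfl⟩
    · exact ⟨Sum.inr (toLex (Sum.inr d)), rfl⟩
  · rintro (x | x) (y | y) h <;> induction x using Lex.rec with | _ x <;>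
      induction y using Lex.rec with | _ y <;> rcases x with x | x <;> rcases y with y | y <;>
      simp_all [chiMap, Sum.Lex.toLex_le_toLex]
end

section
/- Let P and Q be partial orders. A linearisation of a partial order on a type X is a linear (total) order relation on X extending the given order. Then restriction gives a bijection between linearisations of the ordinal sum P ⊕ₗ Q and pairs consisting of a linearisation of P and a linearisation of Q: every linearisation of P ⊕ₗ Q places all elements of P below all elements of Q and restricts to linearisations of P and Q, and conversely each pair of linearisations determines a unique linearisation of P ⊕ₗ Q. In symbols, Lin(P ⊙ Q) ≅ Lin(P) × Lin(Q). -/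
/-- A linearisation of a partial order on `X`: a linear (total) order relation on `X`
extending the given order. -/
structure Linearisation (X : Type*) [PartialOrder X] where
  le : X → X → Prop
  refl : ∀ a : X, le a a
  trans : ∀ a b c : X, le a b → le b c → le a c
  antisymm : ∀ a b : X, le a b → le b a → a = b
  total : ∀ a b : X, le a b ∨ le b a
  extends_le : ∀ a b : X, a ≤ b → le a b

namespace Linearisation

variable {X Y P Q : Type*} [PartialOrder X] [PartialOrder Y] [PartialOrder P] [PartialOrder Q]

@[ext]
theorem ext_le {L M : Linearisation X} (h : ∀ a b, L.le a b ↔ M.le a b) : L = M := by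
  cases L
  cases M
  congr
  ext a b
  exact h a b

/-- The restriction of a linearisation along an order embedding. -/
def comap (f : X ↪o Y) (L : Linearisation Y) : Linearisation X where
  le a b := L.le (f a) (f b)
  refl _ := L.refl _
  trans _ _ _ := L.trans _ _ _
  antisymm _ _ hab hba := f.injective (L.antisymm _ _ hab hba)
  total _ _ := L.total _ _
  extends_le _ _ h := L.extends_le _ _ (f.le_iff_le.2 h)

/-- The linearisation of an ordinal sum determined by linearisations of the summands. -/
def sumLex (A : Linearisation P) (B : Linearisation Q) : Linearisation (P ⊕ₗ Q) where
  le x y := Sum.Lex A.le B.le (ofLex x) (ofLex y)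
  refl x := by
    rcases x with a | b
    · exact .inl (A.refl a)
    · exact .inr (B.refl b)
  trans := by
    rintro (a | a) (b | b) (c | c) (h | h | _) (k | k | _)
    · exact .inl (A.trans _ _ _ h k)
    · exact .sep _ _
    · exact .sep _ _
    · exact .inr (B.trans _ _ _ h k)
  antisymm := by
    rintro (a | a) (b | b) (h | h | _) (k | k | _)
    · exact congrArg (fun p => toLex (Sum.inl p)) (A.antisymm _ _ h k)
    · exact congrArg (fun q => toLex (Sum.inr q)) (B.antisymm _ _ h k)
  total := by
    rintro (a | a) (b | b)
    · exact (A.total a b).imp .inl .inl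
    · exact .inl (.sep _ _)
    · exact .inr (.sep _ _)
    · exact (B.total a b).imp .inr .inr
  extends_le x y h := (Sum.Lex.le_def.1 h).mono A.extends_le B.extends_le

theorem le_inl_inr (L : Linearisation (P ⊕ₗ Q)) (a : P) (b : Q) :
    L.le (toLex (Sum.inl a)) (toLex (Sum.inr b)) :=
  L.extends_le _ _ (Sum.Lex.inl_le_inr a b)

theorem not_le_inr_inl (L : Linearisation (P ⊕ₗ Q)) (a : P) (b : Q) :
    ¬ L.le (toLex (Sum.inr b)) (toLex (Sum.inl a)) := fun h =>
  Sum.inl_ne_inr (toLex.injective (L.antisymm _ _ (L.le_inl_inr a b) h))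

/-- The inclusion of the lower summand in an ordinal sum. -/
def inlEmbedding : P ↪o P ⊕ₗ Q where
  toFun a := toLex (Sum.inl a)
  inj' := toLex.injective.comp Sum.inl_injective
  map_rel_iff' := Sum.Lex.inl_le_inl_iff

/-- The inclusion of the upper summand in an ordinal sum. -/
def inrEmbedding : Q ↪o P ⊕ₗ Q where
  toFun b := toLex (Sum.inr b)
  inj' := toLex.injective.comp Sum.inr_injective
  map_rel_iff' := Sum.Lex.inr_le_inr_iff

/-- Restriction to the summands, as an equivalence between the linearisations of an ordinal sum
and the pairs of linearisations of its summands. -/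
def sumLexEquiv : Linearisation (P ⊕ₗ Q) ≃ Linearisation P × Linearisation Q where
  toFun L := (L.comap inlEmbedding, L.comap inrEmbedding)
  invFun AB := AB.1.sumLex AB.2
  left_inv L := by
    ext x y
    rcases x with a | a <;> rcases y with b | b
    · exact Sum.lex_inl_inl
    · exact iff_of_true (.sep _ _) (L.le_inl_inr a b)
    · exact iff_of_false Sum.lex_inr_inl (L.not_le_inr_inl b a)
    · exact Sum.lex_inr_inr
  right_inv AB := by
    exact Prod.ext (ext_le fun _ _ => Sum.lex_inl_inl) (ext_le fun _ _ => Sum.lex_inr_inr)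

end Linearisation

/-- Restriction gives a bijection `Lin(P ⊙ Q) ≅ Lin(P) × Lin(Q)`: every linearisation of
the ordinal sum `P ⊕ₗ Q` places all elements of `P` below all elements of `Q` and
restricts to linearisations of `P` and of `Q`, and this correspondence is bijective. -/
theorem linearisations_of_ordinal_sum {P Q : Type*} [PartialOrder P] [PartialOrder Q] :
    (∀ L : Linearisation (P ⊕ₗ Q), ∀ (a : P) (b : Q),
        L.le (toLex (Sum.inl a)) (toLex (Sum.inr b))) ∧
    ∃ e : Linearisation (P ⊕ₗ Q) ≃ Linearisation P × Linearisation Q,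
      ∀ L : Linearisation (P ⊕ₗ Q),
        (∀ a a' : P, (e L).1.le a a' ↔ L.le (toLex (Sum.inl a)) (toLex (Sum.inl a'))) ∧
        (∀ b b' : Q, (e L).2.le b b' ↔ L.le (toLex (Sum.inr b)) (toLex (Sum.inr b'))) :=
  ⟨Linearisation.le_inl_inr, Linearisation.sumLexEquiv, fun _ =>
    ⟨fun _ _ => Iff.rfl, fun _ _ => Iff.rfl⟩⟩
end
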